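/- arXiv:2402.03065 — 2 statements merged into one kernel-verified Lean document; each statement's English description precedes it below -/
import Mathlib

section
/- Let T be a 2-tree on [n−1] and suppose the Mandelstam invariants s are generic for T. Then every critical point x of the scattering potential L_T in U satisfies p_{ij}(x) = ε_{{i,j}}·P_{{i,j}}(s) for every edge {i,j} of T other than {1,2}; that is, the evaluation of each Plücker coordinate p_{ij} at the unique critical point equals, up to sign, the product of the factors [s_c]/([s_{{i',k}}]+[s_{{j',k}}]) over all triangles {i',j',k} of T ancestral to the edge {i,j}. -/
namespace MinKin

noncomputable section

attribute [local instance] Classical.propDecidable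

open scoped BigOperators

/-- First row of the 2×n matrix X, at column `j` (1-based). -/
def colA (n j : ℕ) : ℂ := if j = n then 0 else 1

/-- Second row of X at column `j` (1-based): `(0,1,x_1,…,x_{n-3},1)`. -/
def colB (n : ℕ) (x : Fin (n - 3) → ℂ) (j : ℕ) : ℂ :=
  if j = 1 then 0
  else if j = 2 then 1
  else if j = n then 1
  else if h : j - 3 < n - 3 then x ⟨j - 3, h⟩ else 0

/-- The Plücker coordinate `p_{ij}(x)`, the 2×2 minor of X on columns i and j. -/
def pc (n : ℕ) (x : Fin (n - 3) → ℂ) (i j : ℕ) : ℂ :=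
  colA n i * colB n x j - colA n j * colB n x i

/-- The partial derivative `∂p_{ij}/∂x_m` (with `m : Fin (n-3)` zero-based, so that
the variable `x m` appears in column `(m:ℕ)+3` of X). -/
def dpc (n : ℕ) (i j : ℕ) (m : Fin (n - 3)) : ℂ :=
  colA n i * (if j = (m : ℕ) + 3 then (1 : ℂ) else 0)
    - colA n j * (if i = (m : ℕ) + 3 then (1 : ℂ) else 0)

/-- The index set `S = {(i,j) : 1 ≤ i < j ≤ n-1, (i,j) ≠ (1,2)}`. -/
def Sfin (n : ℕ) : Finset (ℕ × ℕ) :=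
  ((Finset.Icc 1 (n - 1)) ×ˢ (Finset.Icc 1 (n - 1))).filter
    (fun e => e.1 < e.2 ∧ e ≠ (1, 2))

/-- The domain `U = {x : p_{ij}(x) ≠ 0 for all (i,j) ∈ S}`. -/
def Udom (n : ℕ) : Set (Fin (n - 3) → ℂ) :=
  {x | ∀ e ∈ Sfin n, pc n x e.1 e.2 ≠ 0}

/-- `x` is a critical point of `L_{T₀} = Σ_{e ∈ T₀} s_e · log p_e`. -/
def IsCrit (n : ℕ) (T₀ : Finset (ℕ × ℕ)) (s : ℕ × ℕ → ℂ) (x : Fin (n - 3) → ℂ) : Prop :=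
  ∀ m : Fin (n - 3), ∑ e ∈ T₀, s e * dpc n e.1 e.2 m / pc n x e.1 e.2 = 0

/-- Edge sets built inductively from the parent choices `par`. -/
def edgesUpTo (par : ℕ → ℕ × ℕ) : ℕ → Finset (ℕ × ℕ)
  | 0 => {(1, 2)}
  | k + 1 =>
      if k + 1 < 3 then {(1, 2)}
      else edgesUpTo par k ∪ {((par (k + 1)).1, k + 1), ((par (k + 1)).2, k + 1)}

/-- A 2-tree on `[n-1]`: for each `k = 3,…,n-1` an already-present edge
`par k = (i_k, j_k)` with `i_k < j_k ≤ k-1` is chosen, and the edges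
`(i_k, k)` and `(j_k, k)` are added. -/
structure TwoTree (n : ℕ) : Type where
  par : ℕ → ℕ × ℕ
  lt : ∀ k, 3 ≤ k → k ≤ n - 1 → (par k).1 < (par k).2 ∧ (par k).2 < k
  mem : ∀ k, 3 ≤ k → k ≤ n - 1 → par k ∈ edgesUpTo par (k - 1)

/-- The edge set of a 2-tree. -/
def TwoTree.edges {n : ℕ} (T : TwoTree n) : Finset (ℕ × ℕ) := edgesUpTo T.par (n - 1)

/-- A finite edge set is a 2-tree on `[n-1]`. -/
def IsTwoTree (n : ℕ) (E : Finset (ℕ × ℕ)) : Prop := ∃ T : TwoTree n, T.edges = E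

/-- `c` is a child of `e` in the 2-tree `T`. -/
def Child (n : ℕ) (T : TwoTree n) (e c : ℕ × ℕ) : Prop :=
  ∃ k, 3 ≤ k ∧ k ≤ n - 1 ∧ T.par k = e ∧ (c = (e.1, k) ∨ c = (e.2, k))

/-- The set `dec(e)` of descendants of the edge `e` (including `e` itself). -/
def dec (n : ℕ) (T : TwoTree n) (e : ℕ × ℕ) : Finset (ℕ × ℕ) :=
  T.edges.filter (fun f => Relation.ReflTransGen (Child n T) e f)

/-- The bracket `[s_e] = Σ_{f ∈ dec(e)} s_f`. -/
def brk (n : ℕ) (T : TwoTree n) (s : ℕ × ℕ → ℂ) (e : ℕ × ℕ) : ℂ :=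
  ∑ f ∈ dec n T e, s f

/-- The Mandelstam invariants `s` are generic for `T`. -/
def Generic (n : ℕ) (T : TwoTree n) (s : ℕ × ℕ → ℂ) : Prop :=
  ∀ k, 3 ≤ k → k ≤ n - 1 →
    brk n T s ((T.par k).1, k) ≠ 0 ∧ brk n T s ((T.par k).2, k) ≠ 0 ∧
      brk n T s ((T.par k).1, k) + brk n T s ((T.par k).2, k) ≠ 0

/-- `a_e = |dec(e)|`. -/
def aA (n : ℕ) (T : TwoTree n) (e : ℕ × ℕ) : ℕ := (dec n T e).card

/-- `v_T(e)`: the number of triangles of `T` containing the edge `e`. -/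
def vT (n : ℕ) (T : TwoTree n) (e : ℕ × ℕ) : ℕ :=
  ((Finset.Icc 3 (n - 1)).filter
    (fun k => e = T.par k ∨ e = ((T.par k).1, k) ∨ e = ((T.par k).2, k))).card

/-- The Horn product `P_e(s)`: over all ancestral triangles `{i,j,k}` of `e`, the
factor `[s_c]/([s_{(i,k)}]+[s_{(j,k)}])` where `c` is the child containing `e`
among its descendants. -/
def hornP (n : ℕ) (T : TwoTree n) (s : ℕ × ℕ → ℂ) (e : ℕ × ℕ) : ℂ :=
  ∏ k ∈ Finset.Icc 3 (n - 1),
    (if e ∈ dec n T ((T.par k).1, k) then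
        brk n T s ((T.par k).1, k)
          / (brk n T s ((T.par k).1, k) + brk n T s ((T.par k).2, k))
      else if e ∈ dec n T ((T.par k).2, k) then
        brk n T s ((T.par k).2, k)
          / (brk n T s ((T.par k).1, k) + brk n T s ((T.par k).2, k))
      else 1)

/-- Auxiliary recursion for the signs `ε_e`. -/
def epsAux (par : ℕ → ℕ × ℕ) : ℕ → ℕ × ℕ → ℂ
  | 0, _ => 1
  | k + 1, e =>
      if e = (1, 2) then 1
      else if e = ((par (k + 1)).1, k + 1) then epsAux par k (par (k + 1))
      else if e = ((par (k + 1)).2, k + 1) then -(epsAux par k (par (k + 1)))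
      else epsAux par k e

/-- The sign `ε_e ∈ {1,-1}`: `ε_{(1,2)} = 1`, `ε_{(i,k)} = ε_{(i,j)}`,
`ε_{(j,k)} = -ε_{(i,j)}` for each triangle `{i,j,k}`. -/
def eps (n : ℕ) (T : TwoTree n) (e : ℕ × ℕ) : ℂ := epsAux T.par (n - 1) e

/-- The negated Hessian matrix `𝓗(x) = -Hess(L_{T₀})(x)`. -/
def negHess (n : ℕ) (T₀ : Finset (ℕ × ℕ)) (s : ℕ × ℕ → ℂ) (x : Fin (n - 3) → ℂ) :
    Matrix (Fin (n - 3)) (Fin (n - 3)) ℂ :=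
  Matrix.of fun (l m : Fin (n - 3)) =>
    ∑ e ∈ T₀, s e * dpc n e.1 e.2 l * dpc n e.1 e.2 m / pc n x e.1 e.2 ^ 2

/-- The on-shell diagram of `T`: the triangles of `T` together with `(1,2,n)`. -/
def triples (n : ℕ) (T : TwoTree n) : Finset (ℕ × ℕ × ℕ) :=
  insert (1, 2, n) ((Finset.Icc 3 (n - 1)).image fun k => ((T.par k).1, (T.par k).2, k))

/-- The edge `e` is contained in the triple `t`. -/
def inTriple (e : ℕ × ℕ) (t : ℕ × ℕ × ℕ) : Prop :=
  e = (t.1, t.2.1) ∨ e = (t.1, t.2.2) ∨ e = (t.2.1, t.2.2)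

/-- `ṽ(e)`: the number of triples of the on-shell diagram containing `e`. -/
def vTil (n : ℕ) (T : TwoTree n) (e : ℕ × ℕ) : ℕ :=
  ((triples n T).filter (inTriple e)).card

/-- The edges contained in at least one triple of the on-shell diagram. -/
def diagEdges (n : ℕ) (T : TwoTree n) : Finset (ℕ × ℕ) :=
  (triples n T).biUnion fun t => {(t.1, t.2.1), (t.1, t.2.2), (t.2.1, t.2.2)}

/-- The CHY integrand `I_T(x) = Π_e p_e(x)^{ṽ(e)-2}`. -/
def integrand (n : ℕ) (T : TwoTree n) (x : Fin (n - 3) → ℂ) : ℂ :=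
  ∏ e ∈ diagEdges n T, pc n x e.1 e.2 ^ ((vTil n T e : ℤ) - 2)

/-- The Horn matrix `H_T`: rows come in consecutive triples indexed by the triangles
(in order k = 3,…,n-1), columns indexed by the non-initial edges of `T`
(in order (i_3,3),(j_3,3),(i_4,4),(j_4,4),…). -/
def HornMat (n : ℕ) (T : TwoTree n) : Matrix (Fin (3 * n - 9)) (Fin (2 * n - 6)) ℤ :=
  Matrix.of fun (ρ : Fin (3 * n - 9)) (c : Fin (2 * n - 6)) =>
    let k := (ρ : ℕ) / 3 + 3
    let c1 : ℕ × ℕ := ((T.par k).1, k)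
    let c2 : ℕ × ℕ := ((T.par k).2, k)
    let kc := (c : ℕ) / 2 + 3
    let e : ℕ × ℕ := if (c : ℕ) % 2 = 0 then ((T.par kc).1, kc) else ((T.par kc).2, kc)
    if (ρ : ℕ) % 3 = 0 then (if e ∈ dec n T c1 then 1 else 0)
    else if (ρ : ℕ) % 3 = 1 then (if e ∈ dec n T c2 then 1 else 0)
    else (if e ∈ dec n T c1 ∨ e ∈ dec n T c2 then -1 else 0)

/-- The matrix `A` whose r-th row has 1 in columns 3r-2, 3r-1, 3r (1-based). -/
def Amat (n : ℕ) : Matrix (Fin (n - 3)) (Fin (3 * n - 9)) ℤ :=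
  Matrix.of fun (r : Fin (n - 3)) (c : Fin (3 * n - 9)) =>
    if (c : ℕ) / 3 = (r : ℕ) then 1 else 0

/-- Polynomial version of the first row of X. -/
def colAP (n : ℕ) (j : ℕ) : MvPolynomial (Fin (n - 3)) ℂ := if j = n then 0 else 1

/-- Polynomial version of the second row of X. -/
def colBP (n : ℕ) (j : ℕ) : MvPolynomial (Fin (n - 3)) ℂ :=
  if j = 1 then 0
  else if j = 2 then 1
  else if j = n then 1
  else if h : j - 3 < n - 3 then MvPolynomial.X ⟨j - 3, h⟩ else 0

/-- The Plücker coordinate `p_{ij}` as a polynomial in `ℂ[x_1,…,x_{n-3}]`. -/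
def pcP (n : ℕ) (i j : ℕ) : MvPolynomial (Fin (n - 3)) ℂ :=
  colAP n i * colBP n j - colAP n j * colBP n i

/-- The r-th triple (0-based row index) of the on-shell diagram of `T`. -/
def tripleOf (n : ℕ) (T : TwoTree n) (r : ℕ) : ℕ × ℕ × ℕ :=
  if r + 3 ≤ n - 1 then ((T.par (r + 3)).1, (T.par (r + 3)).2, r + 3) else (1, 2, n)

/-- The matrix `M_T` over `ℂ[x_1,…,x_{n-3}]`, whose row indexed by a triple
`{i,j,k}` (i<j<k) is `p_{jk}·e_i - p_{ik}·e_j + p_{ij}·e_k`. -/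
def Mmat (n : ℕ) (T : TwoTree n) :
    Matrix (Fin (n - 2)) (Fin n) (MvPolynomial (Fin (n - 3)) ℂ) :=
  Matrix.of fun (r : Fin (n - 2)) (c : Fin n) =>
    if (c : ℕ) + 1 = (tripleOf n T r).1 then
      pcP n (tripleOf n T r).2.1 (tripleOf n T r).2.2
    else if (c : ℕ) + 1 = (tripleOf n T r).2.1 then
      -pcP n (tripleOf n T r).1 (tripleOf n T r).2.2
    else if (c : ℕ) + 1 = (tripleOf n T r).2.2 then
      pcP n (tripleOf n T r).1 (tripleOf n T r).2.1
    else 0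

/-- The matrix `M_T` evaluated at a point `x ∈ ℂ^{n-3}`. -/
def MmatC (n : ℕ) (T : TwoTree n) (x : Fin (n - 3) → ℂ) : Matrix (Fin (n - 2)) (Fin n) ℂ :=
  Matrix.of fun (r : Fin (n - 2)) (c : Fin n) =>
    if (c : ℕ) + 1 = (tripleOf n T r).1 then
      pc n x (tripleOf n T r).2.1 (tripleOf n T r).2.2
    else if (c : ℕ) + 1 = (tripleOf n T r).2.1 then
      -pc n x (tripleOf n T r).1 (tripleOf n T r).2.2
    else if (c : ℕ) + 1 = (tripleOf n T r).2.2 then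
      pc n x (tripleOf n T r).1 (tripleOf n T r).2.1
    else 0

/-- The 2×n matrix X evaluated at `x`. -/
def Xmat (n : ℕ) (x : Fin (n - 3) → ℂ) : Matrix (Fin 2) (Fin n) ℂ :=
  Matrix.of fun (r : Fin 2) (c : Fin n) =>
    if r = 0 then colA n ((c : ℕ) + 1) else colB n x ((c : ℕ) + 1)

/-- The monotone embedding `Fin (n-2) → Fin n` skipping the (0-based) positions
`a < b`. -/
def delCols (n a b : ℕ) (d : Fin (n - 2)) : Fin n :=
  ⟨if (d : ℕ) < a then (d : ℕ) else if (d : ℕ) + 1 < b then (d : ℕ) + 1 else (d : ℕ) + 2, by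
    have := d.isLt; split_ifs <;> omega⟩

/-- The maximal minor of `M_T` obtained by deleting columns `i < j` (1-based). -/
def maxMinor (n : ℕ) (T : TwoTree n) (i j : ℕ) : MvPolynomial (Fin (n - 3)) ℂ :=
  Matrix.det (Matrix.of fun (r d : Fin (n - 2)) => Mmat n T r (delCols n (i - 1) (j - 1) d))

/-- `Δ_T = Π_e p_e^{ṽ(e)-1}`. -/
def DeltaT (n : ℕ) (T : TwoTree n) : MvPolynomial (Fin (n - 3)) ℂ :=
  ∏ e ∈ diagEdges n T, pcP n e.1 e.2 ^ (vTil n T e - 1)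

/-- `T₀` has, for generic coefficients, exactly one critical point in `U`. -/
def UniqueCritGeneric (n : ℕ) (T₀ : Finset (ℕ × ℕ)) : Prop :=
  ∃ g : MvPolynomial {e : ℕ × ℕ // e ∈ T₀} ℂ, g ≠ 0 ∧
    ∀ s : ℕ × ℕ → ℂ, MvPolynomial.eval (fun v => s v.1) g ≠ 0 →
      ∃! x : Fin (n - 3) → ℂ, x ∈ Udom n ∧ IsCrit n T₀ s x

/-- `T₀ ⊆ S` exhibits minimal kinematics. -/
def ExhibitsMinKin (n : ℕ) (T₀ : Finset (ℕ × ℕ)) : Prop :=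
  T₀ ⊆ Sfin n ∧ UniqueCritGeneric n T₀ ∧
    ∀ T₁ : Finset (ℕ × ℕ), T₁ ⊆ Sfin n → T₀ ⊆ T₁ → UniqueCritGeneric n T₁ → T₁ = T₀

section HornPoint

variable {n : ℕ}

theorem mem_edgesUpTo_succ {par : ℕ → ℕ × ℕ} {k : ℕ} (hk : 2 ≤ k) {e : ℕ × ℕ} :
    e ∈ edgesUpTo par (k + 1) ↔
      e ∈ edgesUpTo par k ∨ e = ((par (k + 1)).1, k + 1) ∨ e = ((par (k + 1)).2, k + 1) := by
  rw [edgesUpTo, if_neg (by omega)]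
  simp only [Finset.mem_union, Finset.mem_insert, Finset.mem_singleton]

theorem edgesUpTo_two (par : ℕ → ℕ × ℕ) : edgesUpTo par 2 = {(1, 2)} := by
  simp [edgesUpTo]

theorem edgesUpTo_mono {par : ℕ → ℕ × ℕ} {k l : ℕ} (hk : 2 ≤ k) (hkl : k ≤ l) :
    edgesUpTo par k ⊆ edgesUpTo par l := by
  induction l, hkl using Nat.le_induction with
  | base => exact Finset.Subset.refl _
  | succ l hl ih => exact fun e he => (mem_edgesUpTo_succ (by omega)).2 (Or.inl (ih he))

theorem TwoTree.bounds_of_mem (T : TwoTree n) {k : ℕ} (hk : 2 ≤ k) (hkn : k ≤ n - 1) :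
    ∀ e ∈ edgesUpTo T.par k, 1 ≤ e.1 ∧ e.1 < e.2 ∧ e.2 ≤ k := by
  induction k, hk using Nat.le_induction with
  | base => simp [edgesUpTo_two]
  | succ k hk ih =>
    intro e he
    have hlt := T.lt (k + 1) (by omega) hkn
    have hpar := ih (by omega) _ (T.mem (k + 1) (by omega) hkn)
    rcases (mem_edgesUpTo_succ hk).1 he with he | rfl | rfl
    · have := ih (by omega) e he
      omega
    · dsimp only
      omega
    · dsimp only
      omega

theorem TwoTree.fst_mem (T : TwoTree n) {k : ℕ} (hk : 3 ≤ k) (hkn : k ≤ n - 1) :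
    ((T.par k).1, k) ∈ T.edges := by
  obtain ⟨k, rfl⟩ : ∃ l, k = l + 1 := ⟨k - 1, by omega⟩
  exact edgesUpTo_mono (by omega) hkn ((mem_edgesUpTo_succ (by omega)).2 (Or.inr (Or.inl rfl)))

theorem TwoTree.snd_mem (T : TwoTree n) {k : ℕ} (hk : 3 ≤ k) (hkn : k ≤ n - 1) :
    ((T.par k).2, k) ∈ T.edges := by
  obtain ⟨k, rfl⟩ : ∃ l, k = l + 1 := ⟨k - 1, by omega⟩
  exact edgesUpTo_mono (by omega) hkn ((mem_edgesUpTo_succ (by omega)).2 (Or.inr (Or.inr rfl)))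

theorem TwoTree.par_mem (T : TwoTree n) {k : ℕ} (hk : 3 ≤ k) (hkn : k ≤ n - 1) :
    T.par k ∈ T.edges :=
  edgesUpTo_mono (by omega) (by omega) (T.mem k hk hkn)

/-! ### The descendant order -/

theorem child_iff {T : TwoTree n} {e c : ℕ × ℕ} :
    Child n T e c ↔ 3 ≤ c.2 ∧ c.2 ≤ n - 1 ∧ T.par c.2 = e ∧
      (c = ((T.par c.2).1, c.2) ∨ c = ((T.par c.2).2, c.2)) := by
  constructor
  · rintro ⟨k, h3, hk, rfl, rfl | rfl⟩ <;> simp [h3, hk]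
  · rintro ⟨h3, hk, rfl, h⟩
    exact ⟨c.2, h3, hk, rfl, h⟩

theorem Child.snd_lt {T : TwoTree n} {e c : ℕ × ℕ} (h : Child n T e c) : e.2 < c.2 := by
  obtain ⟨h3, hk, rfl, -⟩ := child_iff.1 h
  exact (T.lt _ h3 hk).2

theorem Child.mem_edges {T : TwoTree n} {e c : ℕ × ℕ} (h : Child n T e c) : c ∈ T.edges := by
  obtain ⟨k, h3, hk, rfl, rfl | rfl⟩ := h
  exacts [T.fst_mem h3 hk, T.snd_mem h3 hk]

theorem child_unique {T : TwoTree n} {e e' c : ℕ × ℕ} (h : Child n T e c) (h' : Child n T e' c) :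
    e = e' :=
  (child_iff.1 h).2.2.1.symm.trans (child_iff.1 h').2.2.1

theorem snd_le_of_descendant {T : TwoTree n} {e f : ℕ × ℕ}
    (h : Relation.ReflTransGen (Child n T) e f) : e.2 ≤ f.2 := by
  induction h with
  | refl => exact le_rfl
  | tail _ hc ih => exact ih.trans hc.snd_lt.le

theorem snd_le_of_mem_dec {T : TwoTree n} {e f : ℕ × ℕ} (h : f ∈ dec n T e) : e.2 ≤ f.2 :=
  snd_le_of_descendant (Finset.mem_filter.1 h).2

theorem self_mem_dec {T : TwoTree n} {e : ℕ × ℕ} (he : e ∈ T.edges) : e ∈ dec n T e :=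
  Finset.mem_filter.2 ⟨he, .refl⟩

theorem mem_dec_child {T : TwoTree n} {a e c : ℕ × ℕ} (he : e ∈ T.edges) (h : Child n T e c) :
    c ∈ dec n T a ↔ c = a ∨ e ∈ dec n T a := by
  simp only [dec, Finset.mem_filter, he, h.mem_edges, true_and]
  rw [Relation.ReflTransGen.cases_tail_iff]
  constructor
  · rintro (rfl | ⟨e', h', hc⟩)
    · exact Or.inl rfl
    · exact Or.inr (child_unique hc h ▸ h')
  · rintro (rfl | h')
    · exact Or.inl rfl
    · exact Or.inr ⟨e, h', h⟩

theorem disjoint_dec_of_child {T : TwoTree n} {e c c' : ℕ × ℕ} (h : Child n T e c)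
    (h' : Child n T e c') (hne : c ≠ c') : Disjoint (dec n T c) (dec n T c') := by
  have key : ∀ {a b : ℕ × ℕ}, Child n T e a → Child n T e b → a ≠ b →
      ¬ Relation.ReflTransGen (Child n T) a b := by
    intro a b ha hb hab hr
    rcases Relation.ReflTransGen.cases_tail hr with rfl | ⟨d, hd, hdb⟩
    · exact hab rfl
    · obtain rfl := child_unique hdb hb
      have := snd_le_of_descendant hd
      have := ha.snd_lt
      omega
  rw [Finset.disjoint_left]
  intro f hf hf'
  have hr := (Finset.mem_filter.1 hf).2
  have hr' := (Finset.mem_filter.1 hf').2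
  rcases Relation.ReflTransGen.total_of_right_unique (r := Function.swap (Child n T))
    (fun _ _ _ => child_unique) hr.swap hr'.swap with hh | hh
  · exact key h' h hne.symm hh.swap
  · exact key h h' hne hh.swap

/-- The children of an edge. -/
def children (T : TwoTree n) (e : ℕ × ℕ) : Finset (ℕ × ℕ) :=
  T.edges.filter (Child n T e)

theorem mem_children {T : TwoTree n} {e c : ℕ × ℕ} : c ∈ children T e ↔ Child n T e c := by
  simpa [children] using fun h : Child n T e c => h.mem_edges

theorem dec_eq_insert_biUnion {T : TwoTree n} {e : ℕ × ℕ} (he : e ∈ T.edges) :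
    dec n T e = insert e ((children T e).biUnion (dec n T)) := by
  ext f
  simp only [Finset.mem_insert, Finset.mem_biUnion, mem_children, dec, Finset.mem_filter]
  constructor
  · rintro ⟨hf, h⟩
    rcases Relation.ReflTransGen.cases_head h with rfl | ⟨c, hc, hcf⟩
    · exact Or.inl rfl
    · exact Or.inr ⟨c, hc, hf, hcf⟩
  · rintro (rfl | ⟨c, hc, hf, hcf⟩)
    · exact ⟨he, .refl⟩
    · exact ⟨hf, .head hc hcf⟩

theorem brk_eq_add_sum_children (T : TwoTree n) (s : ℕ × ℕ → ℂ) {e : ℕ × ℕ} (he : e ∈ T.edges) :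
    brk n T s e = s e + ∑ c ∈ children T e, brk n T s c := by
  rw [brk, dec_eq_insert_biUnion he, Finset.sum_insert, Finset.sum_biUnion]
  · rfl
  · intro c hc c' hc' hne
    exact disjoint_dec_of_child (mem_children.1 hc) (mem_children.1 hc') hne
  · simp only [Finset.mem_biUnion, mem_children, not_exists, not_and]
    intro c hc hmem
    have := hc.snd_lt
    have := snd_le_of_mem_dec hmem
    omega

/-! ### Elimination of the vertices in decreasing order -/

/-- The weight of `e` after the vertices larger than `k` have been eliminated. -/
def weight (T : TwoTree n) (s : ℕ × ℕ → ℂ) (k : ℕ) (e : ℕ × ℕ) : ℂ :=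
  s e + ∑ c ∈ (children T e).filter (fun c => k < c.2), brk n T s c

theorem weight_of_le (T : TwoTree n) (s : ℕ × ℕ → ℂ) {e : ℕ × ℕ} {k : ℕ} (hk : n - 1 ≤ k) :
    weight T s k e = s e := by
  rw [weight, Finset.filter_false_of_mem, Finset.sum_empty, add_zero]
  intro c hc
  have := (child_iff.1 (mem_children.1 hc)).2.1
  omega

theorem weight_eq_brk (T : TwoTree n) (s : ℕ × ℕ → ℂ) {e : ℕ × ℕ} {k : ℕ} (he : e ∈ T.edges)
    (hk : k ≤ e.2) : weight T s k e = brk n T s e := by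
  rw [weight, Finset.filter_true_of_mem, brk_eq_add_sum_children T s he]
  intro c hc
  have := (mem_children.1 hc).snd_lt
  omega

theorem filter_children_snd_eq (T : TwoTree n) {k : ℕ} (hk : 3 ≤ k) (hkn : k ≤ n - 1)
    (e : ℕ × ℕ) : (children T e).filter (fun c => c.2 = k) =
      if e = T.par k then {((T.par k).1, k), ((T.par k).2, k)} else ∅ := by
  ext c
  simp only [Finset.mem_filter, mem_children]
  split_ifs with h
  · subst h
    simp only [Finset.mem_insert, Finset.mem_singleton]
    constructor
    · rintro ⟨hc, rfl⟩
      exact (child_iff.1 hc).2.2.2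
    · intro hc
      exact ⟨⟨k, hk, hkn, rfl, hc⟩, by rcases hc with rfl | rfl <;> rfl⟩
  · simp only [Finset.notMem_empty, iff_false, not_and]
    rintro hc rfl
    exact h (child_iff.1 hc).2.2.1.symm

theorem weight_eq_weight_succ_add (T : TwoTree n) (s : ℕ × ℕ → ℂ) {k : ℕ} (hk : 2 ≤ k)
    (hkn : k + 1 ≤ n - 1) (e : ℕ × ℕ) :
    weight T s k e = weight T s (k + 1) e + if e = T.par (k + 1) then
      brk n T s ((T.par (k + 1)).1, k + 1) + brk n T s ((T.par (k + 1)).2, k + 1) else 0 := by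
  have hsplit : (children T e).filter (fun c => k < c.2) =
      (children T e).filter (fun c => k + 1 < c.2) ∪
        (children T e).filter (fun c => c.2 = k + 1) := by
    rw [← Finset.filter_or]
    exact Finset.filter_congr fun c _ => by omega
  have hlt := T.lt (k + 1) (by omega) hkn
  rw [weight, weight, hsplit, Finset.sum_union, filter_children_snd_eq T (by omega) hkn]
  · split_ifs
    · rw [Finset.sum_pair (by simpa using hlt.1.ne)]
      ring
    · simp
  · rw [Finset.disjoint_filter]
    intros
    omega

theorem pc_eq (x : Fin (n - 3) → ℂ) {i j : ℕ} (hi : i ≠ n) (hj : j ≠ n) :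
    pc n x i j = colB n x j - colB n x i := by
  simp [pc, colA, hi, hj]

theorem dpc_eq (m : Fin (n - 3)) {i j : ℕ} (hi : i ≠ n) (hj : j ≠ n) :
    dpc n i j m = (if j = (m : ℕ) + 3 then (1 : ℂ) else 0) -
      (if i = (m : ℕ) + 3 then (1 : ℂ) else 0) := by
  simp [dpc, colA, hi, hj]

theorem pc_one_two (hn : 4 ≤ n) (x : Fin (n - 3) → ℂ) : pc n x 1 2 = 1 := by
  rw [pc_eq x (by omega) (by omega)]
  simp [colB]

theorem pc_ne_zero (hn : 4 ≤ n) {T : TwoTree n} {x : Fin (n - 3) → ℂ} (hx : x ∈ Udom n)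
    {e : ℕ × ℕ} (he : e ∈ T.edges) : pc n x e.1 e.2 ≠ 0 := by
  by_cases h : e = (1, 2)
  · subst h
    simp [pc_one_two hn]
  · have := T.bounds_of_mem (by omega) le_rfl e he
    refine hx e (Finset.mem_filter.2 ⟨Finset.mem_product.2 ?_, by omega, h⟩)
    simp only [Finset.mem_Icc]
    omega

theorem sum_edgesUpTo_succ (T : TwoTree n) {k : ℕ} (hk : 2 ≤ k) (hkn : k + 1 ≤ n - 1)
    (F : ℕ × ℕ → ℂ) :
    ∑ e ∈ edgesUpTo T.par (k + 1), F e = ∑ e ∈ edgesUpTo T.par k, F e +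
      (F ((T.par (k + 1)).1, k + 1) + F ((T.par (k + 1)).2, k + 1)) := by
  have hlt := T.lt (k + 1) (by omega) hkn
  rw [edgesUpTo, if_neg (by omega), Finset.sum_union, Finset.sum_pair (by simpa using hlt.1.ne)]
  rw [Finset.disjoint_right]
  intro e he hmem
  have := (T.bounds_of_mem hk (by omega) e hmem).2.2
  simp only [Finset.mem_insert, Finset.mem_singleton] at he
  rcases he with rfl | rfl <;> simp at this

/-- The critical equation at vertex `k + 1` after eliminating all larger vertices. -/
theorem triangle_balance {T : TwoTree n} {s : ℕ × ℕ → ℂ} {x : Fin (n - 3) → ℂ} {k : ℕ}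
    (hk : 2 ≤ k) (hkn : k + 1 ≤ n - 1)
    (h : ∀ m, ∑ e ∈ edgesUpTo T.par (k + 1),
      weight T s (k + 1) e * dpc n e.1 e.2 m / pc n x e.1 e.2 = 0) :
    brk n T s ((T.par (k + 1)).1, k + 1) / pc n x (T.par (k + 1)).1 (k + 1) +
      brk n T s ((T.par (k + 1)).2, k + 1) / pc n x (T.par (k + 1)).2 (k + 1) = 0 := by
  have hlt := T.lt (k + 1) (by omega) hkn
  have hm := h ⟨k - 2, by omega⟩
  have hval : k - 2 + 3 = k + 1 := by omega
  rw [sum_edgesUpTo_succ T hk hkn, Finset.sum_eq_zero, zero_add,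
    weight_eq_brk T s (T.fst_mem (by omega) hkn) le_rfl,
    weight_eq_brk T s (T.snd_mem (by omega) hkn) le_rfl,
    dpc_eq _ (by dsimp only; omega) (by dsimp only; omega),
    dpc_eq _ (by dsimp only; omega) (by dsimp only; omega)] at hm
  · dsimp only at hm
    rw [hval, if_pos rfl, if_neg (by omega), if_neg (by omega)] at hm
    simpa using hm
  · intro e he
    have := T.bounds_of_mem hk (by omega) e he
    rw [dpc_eq _ (by omega) (by omega)]
    dsimp only
    rw [hval, if_neg (by omega), if_neg (by omega)]
    simp

theorem elimination_step (hn : 4 ≤ n) {T : TwoTree n} {s : ℕ × ℕ → ℂ} {x : Fin (n - 3) → ℂ}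
    (hx : x ∈ Udom n) {k : ℕ} (hk : 2 ≤ k) (hkn : k + 1 ≤ n - 1)
    (h : ∀ m, ∑ e ∈ edgesUpTo T.par (k + 1),
      weight T s (k + 1) e * dpc n e.1 e.2 m / pc n x e.1 e.2 = 0) (m : Fin (n - 3)) :
    ∑ e ∈ edgesUpTo T.par k, weight T s k e * dpc n e.1 e.2 m / pc n x e.1 e.2 = 0 := by
  have hlt := T.lt (k + 1) (by omega) hkn
  have hpar := T.mem (k + 1) (by omega) hkn
  rw [Nat.add_sub_cancel] at hpar
  have hbal := triangle_balance hk hkn h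
  have hm := h m
  rw [sum_edgesUpTo_succ T hk hkn, weight_eq_brk T s (T.fst_mem (by omega) hkn) le_rfl,
    weight_eq_brk T s (T.snd_mem (by omega) hkn) le_rfl] at hm
  have hik := pc_ne_zero hn hx (T.fst_mem (k := k + 1) (by omega) hkn)
  have hjk := pc_ne_zero hn hx (T.snd_mem (k := k + 1) (by omega) hkn)
  have hij := pc_ne_zero hn hx (T.par_mem (k := k + 1) (by omega) hkn)
  simp only [weight_eq_weight_succ_add T s hk hkn, add_mul, add_div, Finset.sum_add_distrib,
    ite_mul, ite_div, zero_mul, zero_div, Finset.sum_ite_eq', hpar, if_true]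
  rw [← hm]
  congr 1
  have hp : pc n x (T.par (k + 1)).1 (T.par (k + 1)).2 =
      pc n x (T.par (k + 1)).1 (k + 1) - pc n x (T.par (k + 1)).2 (k + 1) := by
    rw [pc_eq, pc_eq, pc_eq] <;> first | omega | ring
  have hd : dpc n (T.par (k + 1)).1 (T.par (k + 1)).2 m =
      dpc n (T.par (k + 1)).1 (k + 1) m - dpc n (T.par (k + 1)).2 (k + 1) m := by
    rw [dpc_eq, dpc_eq, dpc_eq] <;> first | omega | ring
  dsimp only at hik hjk hij ⊢
  rw [hp] at hij
  rw [hp, hd]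
  generalize pc n x (T.par (k + 1)).1 (k + 1) = p at *
  generalize pc n x (T.par (k + 1)).2 (k + 1) = q at *
  generalize brk n T s ((T.par (k + 1)).1, k + 1) = a at *
  generalize brk n T s ((T.par (k + 1)).2, k + 1) = b at *
  generalize dpc n (T.par (k + 1)).1 (k + 1) m = u
  generalize dpc n (T.par (k + 1)).2 (k + 1) m = v
  obtain rfl : b = -(a / p) * q := by
    field_simp at hbal ⊢
    linear_combination hbal
  field_simp
  ring

theorem weighted_critical_equation (hn : 4 ≤ n) {T : TwoTree n} {s : ℕ × ℕ → ℂ}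
    {x : Fin (n - 3) → ℂ} (hx : x ∈ Udom n) (hcrit : IsCrit n (T.edges.erase (1, 2)) s x)
    {k : ℕ} (hk : 2 ≤ k) (hkn : k ≤ n - 1) (m : Fin (n - 3)) :
    ∑ e ∈ edgesUpTo T.par k, weight T s k e * dpc n e.1 e.2 m / pc n x e.1 e.2 = 0 := by
  induction hkn using Nat.decreasingInduction generalizing m with
  | self =>
    simp only [weight_of_le T s le_rfl]
    rw [← hcrit m]
    symm
    refine Finset.sum_erase _ ?_
    rw [dpc_eq _ (by dsimp only; omega) (by dsimp only; omega)]
    simp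
  | of_succ k hkn ih => exact elimination_step hn hx hk hkn (fun m => ih (by omega) m) m

/-! ### The Horn product and the signs along the tree -/

theorem hornP_child (T : TwoTree n) (s : ℕ × ℕ → ℂ) {k : ℕ} (hk : 3 ≤ k) (hkn : k ≤ n - 1) :
    hornP n T s ((T.par k).1, k) = brk n T s ((T.par k).1, k) /
        (brk n T s ((T.par k).1, k) + brk n T s ((T.par k).2, k)) * hornP n T s (T.par k) ∧
    hornP n T s ((T.par k).2, k) = brk n T s ((T.par k).2, k) /
        (brk n T s ((T.par k).1, k) + brk n T s ((T.par k).2, k)) * hornP n T s (T.par k) := by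
  have hlt := T.lt k hk hkn
  have hmem : k ∈ Finset.Icc 3 (n - 1) := Finset.mem_Icc.2 ⟨hk, hkn⟩
  have hnot : ∀ i, T.par k ∉ dec n T (i, k) := fun i h => by
    have := snd_le_of_mem_dec h
    dsimp only at this
    omega
  have hfst : Child n T (T.par k) ((T.par k).1, k) := ⟨k, hk, hkn, rfl, Or.inl rfl⟩
  have hsnd : Child n T (T.par k) ((T.par k).2, k) := ⟨k, hk, hkn, rfl, Or.inr rfl⟩
  have hiff := fun a => mem_dec_child (a := a) (T.par_mem hk hkn) hfst
  have hiff' := fun a => mem_dec_child (a := a) (T.par_mem hk hkn) hsnd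
  constructor
  · simp only [hornP]
    rw [← Finset.mul_prod_erase _ _ hmem, ← Finset.mul_prod_erase _ _ hmem,
      if_pos (self_mem_dec (T.fst_mem hk hkn)), if_neg (hnot _), if_neg (hnot _), one_mul]
    congr 1
    refine Finset.prod_congr rfl fun l hl => ?_
    have hl := (Finset.ne_of_mem_erase hl).symm
    simp [hiff, hl]
  · simp only [hornP]
    rw [← Finset.mul_prod_erase _ _ hmem, ← Finset.mul_prod_erase _ _ hmem,
      if_neg (by simp [hiff', hnot, hlt.1.ne']), if_pos (self_mem_dec (T.snd_mem hk hkn)),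
      if_neg (hnot _), if_neg (hnot _), one_mul]
    congr 1
    refine Finset.prod_congr rfl fun l hl => ?_
    have hl := (Finset.ne_of_mem_erase hl).symm
    simp [hiff', hl]

theorem hornP_one_two (T : TwoTree n) (s : ℕ × ℕ → ℂ) : hornP n T s (1, 2) = 1 := by
  refine Finset.prod_eq_one fun k hk => ?_
  have hnot : ∀ i, (1, 2) ∉ dec n T (i, k) := fun i h => by
    have := snd_le_of_mem_dec h
    have := (Finset.mem_Icc.1 hk).1
    dsimp only at *
    omega
  simp [hnot]

theorem epsAux_one_two (par : ℕ → ℕ × ℕ) (k : ℕ) : epsAux par k (1, 2) = 1 := by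
  cases k <;> simp [epsAux]

theorem epsAux_eq_of_snd_le (par : ℕ → ℕ × ℕ) {e : ℕ × ℕ} {k l : ℕ} (he : e.2 ≤ k)
    (hkl : k ≤ l) : epsAux par l e = epsAux par k e := by
  by_cases h : e = (1, 2)
  · simp [h, epsAux_one_two]
  · induction l, hkl using Nat.le_induction with
    | base => rfl
    | succ l hl ih =>
      have hne : ∀ i, e ≠ (i, l + 1) := fun i h => by
        have := congrArg Prod.snd h
        dsimp only at this
        omega
      rw [epsAux, if_neg h, if_neg (hne _), if_neg (hne _), ih]

theorem eps_child (T : TwoTree n) {k : ℕ} (hk : 3 ≤ k) (hkn : k ≤ n - 1) :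
    eps n T ((T.par k).1, k) = eps n T (T.par k) ∧
      eps n T ((T.par k).2, k) = -eps n T (T.par k) := by
  have hlt := T.lt k hk hkn
  obtain ⟨k, rfl⟩ : ∃ l, k = l + 1 := ⟨k - 1, by omega⟩
  have hne : k + 1 ≠ 2 := by omega
  simp only [eps]
  rw [epsAux_eq_of_snd_le T.par (e := (_, k + 1)) le_rfl hkn,
    epsAux_eq_of_snd_le T.par (e := (_, k + 1)) le_rfl hkn,
    epsAux_eq_of_snd_le T.par (e := T.par (k + 1)) (k := k) (by omega) (by omega)]
  simp [epsAux, hne, hlt.1.ne']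

theorem pc_child (hn : 4 ≤ n) {T : TwoTree n} {s : ℕ × ℕ → ℂ} (hs : Generic n T s)
    {x : Fin (n - 3) → ℂ} (hx : x ∈ Udom n) (hcrit : IsCrit n (T.edges.erase (1, 2)) s x)
    {k : ℕ} (hk : 3 ≤ k) (hkn : k ≤ n - 1) :
    pc n x (T.par k).1 k = brk n T s ((T.par k).1, k) /
        (brk n T s ((T.par k).1, k) + brk n T s ((T.par k).2, k)) *
          pc n x (T.par k).1 (T.par k).2 ∧
    pc n x (T.par k).2 k = -(brk n T s ((T.par k).2, k) /
        (brk n T s ((T.par k).1, k) + brk n T s ((T.par k).2, k)) *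
          pc n x (T.par k).1 (T.par k).2) := by
  have hlt := T.lt k hk hkn
  obtain ⟨k, rfl⟩ : ∃ l, k = l + 1 := ⟨k - 1, by omega⟩
  have hbal := triangle_balance (by omega) hkn
    (weighted_critical_equation hn hx hcrit (by omega) hkn)
  have hsum := (hs (k + 1) hk hkn).2.2
  have hik := pc_ne_zero hn hx (T.fst_mem hk hkn)
  have hjk := pc_ne_zero hn hx (T.snd_mem hk hkn)
  have hp : pc n x (T.par (k + 1)).1 (T.par (k + 1)).2 =
      pc n x (T.par (k + 1)).1 (k + 1) - pc n x (T.par (k + 1)).2 (k + 1) := by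
    rw [pc_eq, pc_eq, pc_eq] <;> first | omega | ring
  dsimp only at hik hjk
  rw [div_add_div _ _ hik hjk, div_eq_zero_iff, or_iff_left (mul_ne_zero hik hjk)] at hbal
  rw [hp]
  constructor
  · rw [div_mul_eq_mul_div, eq_div_iff hsum]
    linear_combination hbal
  · rw [div_mul_eq_mul_div, ← neg_div, eq_div_iff hsum]
    linear_combination hbal

theorem pc_eq_eps_mul_hornP (hn : 4 ≤ n) {T : TwoTree n} {s : ℕ × ℕ → ℂ} (hs : Generic n T s)
    {x : Fin (n - 3) → ℂ} (hx : x ∈ Udom n) (hcrit : IsCrit n (T.edges.erase (1, 2)) s x)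
    {k : ℕ} (hk : 2 ≤ k) (hkn : k ≤ n - 1) :
    ∀ e ∈ edgesUpTo T.par k, pc n x e.1 e.2 = eps n T e * hornP n T s e := by
  induction k, hk using Nat.le_induction with
  | base =>
    intro e he
    rw [edgesUpTo_two, Finset.mem_singleton] at he
    subst he
    rw [hornP_one_two, eps, epsAux_one_two, pc_one_two hn, one_mul]
  | succ k hk ih =>
    intro e he
    have hpar := ih (by omega) _ (T.mem (k + 1) (by omega) hkn)
    have hpc := pc_child hn hs hx hcrit (k := k + 1) (by omega) hkn
    have hhorn := hornP_child T s (k := k + 1) (by omega) hkn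
    have heps := eps_child T (k := k + 1) (by omega) hkn
    rcases (mem_edgesUpTo_succ hk).1 he with he | rfl | rfl
    · exact ih (by omega) e he
    · rw [hpc.1, hhorn.1, heps.1, hpar]
      ring
    · rw [hpc.2, hhorn.2, heps.2, hpar]
      ring

end HornPoint

/-- every critical point of L_T in U has Plücker coordinates given,
up to sign, by the Horn products P_e(s). -/
theorem critical_point_is_horn_point (n : ℕ) (hn : 4 ≤ n) (T : TwoTree n)
    (s : ℕ × ℕ → ℂ) (hs : Generic n T s) :
    ∀ x : Fin (n - 3) → ℂ, x ∈ Udom n → IsCrit n (T.edges.erase (1, 2)) s x →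
      ∀ e ∈ T.edges.erase (1, 2), pc n x e.1 e.2 = eps n T e * hornP n T s e := by
  intro x hx hcrit e he
  exact pc_eq_eps_mul_hornP hn hs hx hcrit (by omega) le_rfl e (Finset.mem_of_mem_erase he)

end
end MinKin
end

section
/- Let T be a 2-tree on [n−1] and suppose the Mandelstam invariants s are generic for T. Then a point x ∈ U is a critical point of the scattering potential L_T if and only if [s_{{i,k}}]/p_{ik}(x) + [s_{{j,k}}]/p_{jk}(x) = 0 for every triangle {i,j,k} of T with i < j < k. -/
namespace MinKin

noncomputable section

attribute [local instance] Classical.propDecidable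

open scoped BigOperators

theorem mem_edgesUpTo (par : ℕ → ℕ × ℕ) (N : ℕ) (e : ℕ × ℕ) :
    e ∈ edgesUpTo par N ↔
      e = (1, 2) ∨ ∃ k, 3 ≤ k ∧ k ≤ N ∧ (e = ((par k).1, k) ∨ e = ((par k).2, k)) := by
  induction N with
  | zero =>
    simp only [edgesUpTo, Finset.mem_singleton]
    exact ⟨Or.inl, fun h => h.elim id fun ⟨k, h3, h0, _⟩ => by omega⟩
  | succ N ih =>
    rw [edgesUpTo]
    split_ifs with hN
    · simp only [Finset.mem_singleton]
      exact ⟨Or.inl, fun h => h.elim id fun ⟨k, h3, h0, _⟩ => by omega⟩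
    · simp only [Finset.mem_union, Finset.mem_insert, Finset.mem_singleton, ih]
      constructor
      · rintro ((h | ⟨k, h3, hk, h⟩) | h)
        · exact Or.inl h
        · exact Or.inr ⟨k, h3, by omega, h⟩
        · exact Or.inr ⟨N + 1, by omega, le_rfl, h⟩
      · rintro (h | ⟨k, h3, hk, h⟩)
        · exact Or.inl (Or.inl h)
        · rcases Nat.lt_or_ge N k with hlt | hle
          · obtain rfl : k = N + 1 := by omega
            exact Or.inr h
          · exact Or.inl (Or.inr ⟨k, h3, hle, h⟩)

namespace TwoTree

variable {n : ℕ} (T : TwoTree n)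

theorem mem_edges {e : ℕ × ℕ} :
    e ∈ T.edges ↔ e = (1, 2) ∨
      ∃ k, 3 ≤ k ∧ k ≤ n - 1 ∧ (e = ((T.par k).1, k) ∨ e = ((T.par k).2, k)) :=
  mem_edgesUpTo _ _ _

theorem par_mem_edges {k : ℕ} (h3 : 3 ≤ k) (hk : k ≤ n - 1) : T.par k ∈ T.edges := by
  rcases (mem_edgesUpTo _ _ _).1 (T.mem k h3 hk) with h | ⟨l, h3', hl, h⟩
  · exact T.mem_edges.2 (Or.inl h)
  · exact T.mem_edges.2 (Or.inr ⟨l, h3', by omega, h⟩)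

theorem edges_bounds {e : ℕ × ℕ} (he : e ∈ T.edges) : 1 ≤ e.1 ∧ e.1 < e.2 := by
  induction h : e.2 using Nat.strong_induction_on generalizing e with
  | _ v ih =>
    subst h
    rcases T.mem_edges.1 he with rfl | ⟨k, h3, hk, h⟩
    · simp
    · have hlt := T.lt k h3 hk
      have hek : e.2 = k := by rcases h with rfl | rfl <;> rfl
      have := ih _ (by omega) (T.par_mem_edges h3 hk) rfl
      rcases h with rfl | rfl <;> simp only <;> omega

/-- The non-initial edges are those ending at a vertex `k ≥ 3`. -/
theorem mem_edges_erase {c : ℕ × ℕ} :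
    c ∈ T.edges.erase (1, 2) ↔ (3 ≤ c.2 ∧ c.2 ≤ n - 1) ∧
      (c = ((T.par c.2).1, c.2) ∨ c = ((T.par c.2).2, c.2)) := by
  rw [Finset.mem_erase, T.mem_edges]
  constructor
  · rintro ⟨h0, h | ⟨k, h3, hk, h⟩⟩
    · exact absurd h h0
    · have hck : c.2 = k := by rcases h with rfl | rfl <;> rfl
      subst hck
      exact ⟨⟨h3, hk⟩, h⟩
  · rintro ⟨⟨h3, hk⟩, h⟩
    exact ⟨fun h0 => by rw [h0] at h3; simp at h3, Or.inr ⟨_, h3, hk, h⟩⟩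

theorem sum_edges_erase {M : Type*} [AddCommMonoid M] (F : ℕ × ℕ → M) :
    ∑ c ∈ T.edges.erase (1, 2), F c =
      ∑ k ∈ Finset.Icc 3 (n - 1), (F ((T.par k).1, k) + F ((T.par k).2, k)) := by
  rw [← Finset.sum_fiberwise_of_maps_to (g := Prod.snd) (t := Finset.Icc 3 (n - 1))
    fun c hc => Finset.mem_Icc.2 (T.mem_edges_erase.1 hc).1]
  refine Finset.sum_congr rfl fun k hk => ?_
  obtain ⟨h3, hk⟩ := Finset.mem_Icc.1 hk
  have hlt := T.lt k h3 hk
  have hne : ((T.par k).1, k) ≠ ((T.par k).2, k) := fun h => by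
    have := congrArg Prod.fst h
    simp only at this
    omega
  rw [← Finset.sum_pair hne]
  refine Finset.sum_congr ?_ fun _ _ => rfl
  ext c
  rw [Finset.mem_filter, T.mem_edges_erase, Finset.mem_insert, Finset.mem_singleton]
  constructor
  · rintro ⟨⟨_, h⟩, rfl⟩
    exact h
  · rintro (rfl | rfl) <;> simp [h3, hk]

theorem child_iff {e c : ℕ × ℕ} :
    Child n T e c ↔ c ∈ T.edges.erase (1, 2) ∧ T.par c.2 = e := by
  rw [T.mem_edges_erase]
  constructor
  · rintro ⟨k, h3, hk, rfl, rfl | rfl⟩ <;> simp [h3, hk]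
  · rintro ⟨⟨⟨h3, hk⟩, h⟩, rfl⟩
    exact ⟨c.2, h3, hk, rfl, h⟩

theorem reflTransGen_child_snd_le {e f : ℕ × ℕ}
    (h : Relation.ReflTransGen (Child n T) e f) : e.2 ≤ f.2 := by
  induction h with
  | refl => exact le_rfl
  | tail _ hc ih =>
    obtain ⟨hce, rfl⟩ := T.child_iff.1 hc
    obtain ⟨⟨h3, hk⟩, _⟩ := T.mem_edges_erase.1 hce
    have := T.lt _ h3 hk
    omega

/-- The ancestors of a non-initial edge `f` are `f` and the ancestors of its parent. -/
theorem reflTransGen_child_iff {c f : ℕ × ℕ} (hf : f ∈ T.edges.erase (1, 2)) :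
    Relation.ReflTransGen (Child n T) c f ↔
      f = c ∨ Relation.ReflTransGen (Child n T) c (T.par f.2) := by
  rw [Relation.ReflTransGen.cases_tail_iff]
  refine or_congr_right ⟨?_, fun h => ⟨_, h, T.child_iff.2 ⟨hf, rfl⟩⟩⟩
  rintro ⟨d, hd, hdf⟩
  rwa [(T.child_iff.1 hdf).2]

/-- Telescoping along the chain of ancestors of an edge. -/
theorem sum_ancestors_sub {A : Type*} [AddCommGroup A] (w : ℕ × ℕ → A) {f : ℕ × ℕ}
    (hf : f ∈ T.edges) :
    ∑ c ∈ (T.edges.erase (1, 2)).filter (fun c => Relation.ReflTransGen (Child n T) c f),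
      (w c - w (T.par c.2)) = w f - w (1, 2) := by
  induction h : f.2 using Nat.strong_induction_on generalizing f with
  | _ v ih =>
    subst h
    by_cases h12 : f = (1, 2)
    · subst h12
      rw [sub_self, Finset.filter_false_of_mem, Finset.sum_empty]
      intro c hc hcf
      have := T.reflTransGen_child_snd_le hcf
      have := (T.mem_edges_erase.1 hc).1.1
      simp only at *
      omega
    · have hf' := Finset.mem_erase.2 ⟨h12, hf⟩
      obtain ⟨⟨h3, hk⟩, _⟩ := T.mem_edges_erase.1 hf'
      have hlt := T.lt _ h3 hk
      have hset : (T.edges.erase (1, 2)).filter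
            (fun c => Relation.ReflTransGen (Child n T) c f) =
          insert f ((T.edges.erase (1, 2)).filter
            (fun c => Relation.ReflTransGen (Child n T) c (T.par f.2))) := by
        ext c
        rw [Finset.mem_filter, Finset.mem_insert, Finset.mem_filter,
          T.reflTransGen_child_iff hf']
        constructor
        · rintro ⟨hc, rfl | h⟩
          · exact Or.inl rfl
          · exact Or.inr ⟨hc, h⟩
        · rintro (rfl | ⟨hc, h⟩)
          · exact ⟨hf', Or.inl rfl⟩
          · exact ⟨hc, Or.inr h⟩
      rw [hset, Finset.sum_insert, ih _ hlt.2 (T.par_mem_edges h3 hk) rfl]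
      · abel
      · intro hmem
        have := T.reflTransGen_child_snd_le (Finset.mem_filter.1 hmem).2
        omega

/-- Summation by parts over the descendant order: a weighted sum over the non-initial edges,
rewritten in terms of the brackets. -/
theorem sum_mul_eq_sum_brk (s w : ℕ × ℕ → ℂ) (hw : w (1, 2) = 0) :
    ∑ e ∈ T.edges.erase (1, 2), s e * w e =
      ∑ c ∈ T.edges.erase (1, 2), brk n T s c * (w c - w (T.par c.2)) := by
  have hroot : (1, 2) ∈ T.edges := T.mem_edges.2 (Or.inl rfl)
  calc ∑ e ∈ T.edges.erase (1, 2), s e * w e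
      = ∑ e ∈ T.edges, s e * w e := by
        rw [← Finset.add_sum_erase _ _ hroot, hw, mul_zero, zero_add]
    _ = ∑ f ∈ T.edges, ∑ c ∈ T.edges.erase (1, 2),
          if Relation.ReflTransGen (Child n T) c f then s f * (w c - w (T.par c.2)) else 0 := by
        refine Finset.sum_congr rfl fun f hf => ?_
        rw [← Finset.sum_filter, ← Finset.mul_sum, T.sum_ancestors_sub w hf, hw, sub_zero]
    _ = ∑ c ∈ T.edges.erase (1, 2), brk n T s c * (w c - w (T.par c.2)) := by
        rw [Finset.sum_comm]
        refine Finset.sum_congr rfl fun c _ => ?_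
        rw [← Finset.sum_filter, ← Finset.sum_mul, brk, dec]

end TwoTree

theorem pc_eq_sub {n i j : ℕ} (x : Fin (n - 3) → ℂ) (hi : i ≠ n) (hj : j ≠ n) :
    pc n x i j = colB n x j - colB n x i := by
  simp [pc, colA, hi, hj]

theorem dpc_eq_sub {n i j : ℕ} (m : Fin (n - 3)) (hi : i ≠ n) (hj : j ≠ n) :
    dpc n i j m =
      (if j = (m : ℕ) + 3 then (1 : ℂ) else 0) - (if i = (m : ℕ) + 3 then (1 : ℂ) else 0) := by
  simp [dpc, colA, hi, hj]

theorem pc_ne_zero_s7 {n : ℕ} {x : Fin (n - 3) → ℂ} (hx : x ∈ Udom n) {i j : ℕ}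
    (hi : 1 ≤ i) (hij : i < j) (hj : j < n) : pc n x i j ≠ 0 := by
  by_cases h : (i, j) = (1, 2)
  · obtain ⟨rfl, rfl⟩ := Prod.mk.inj h
    rw [pc_eq_sub x (by omega) (by omega)]
    simp [colB]
  · refine hx (i, j) ?_
    simp only [Sfin, Finset.mem_filter, Finset.mem_product, Finset.mem_Icc]
    exact ⟨⟨by omega, by omega⟩, hij, h⟩

/-- The partial derivative in `x_m` of the potential, as a combination of the triangle
equations: the coefficient of the triangle `{i,j,k}` is supported on the vertices `i,j,k`. -/
theorem sum_dpc_eq_sum_triangles {n : ℕ} (hn : 4 ≤ n) (T : TwoTree n) (s : ℕ × ℕ → ℂ)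
    {x : Fin (n - 3) → ℂ} (hx : x ∈ Udom n) (m : Fin (n - 3)) :
    ∑ e ∈ T.edges.erase (1, 2), s e * dpc n e.1 e.2 m / pc n x e.1 e.2 =
      ∑ k ∈ Finset.Icc 3 (n - 1),
        (brk n T s ((T.par k).1, k) / pc n x (T.par k).1 k
            + brk n T s ((T.par k).2, k) / pc n x (T.par k).2 k) *
          ((if k = (m : ℕ) + 3 then 1 else 0)
            + pc n x (T.par k).2 k / pc n x (T.par k).1 (T.par k).2 *
              (if (T.par k).1 = (m : ℕ) + 3 then 1 else 0)
            - pc n x (T.par k).1 k / pc n x (T.par k).1 (T.par k).2 *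
              (if (T.par k).2 = (m : ℕ) + 3 then 1 else 0)) := by
  have hw : dpc n 1 2 m / pc n x 1 2 = 0 := by
    rw [dpc_eq_sub m (by omega) (by omega), if_neg (by omega), if_neg (by omega)]
    simp
  have hsum := T.sum_mul_eq_sum_brk s (fun e => dpc n e.1 e.2 m / pc n x e.1 e.2) hw
  simp only [← mul_div_assoc] at hsum
  rw [hsum, T.sum_edges_erase]
  refine Finset.sum_congr rfl fun k hk => ?_
  obtain ⟨h3, hk⟩ := Finset.mem_Icc.1 hk
  have hlt := T.lt k h3 hk
  have h1 := (T.edges_bounds (T.par_mem_edges h3 hk)).1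
  dsimp only
  generalize T.par k = e at *
  obtain ⟨i, j⟩ := e
  dsimp only at *
  have hik := pc_ne_zero_s7 hx h1 (hlt.1.trans hlt.2) (by omega)
  have hjk := pc_ne_zero_s7 hx (h1.trans hlt.1.le) hlt.2 (by omega)
  have hij := pc_ne_zero_s7 hx h1 hlt.1 (by omega)
  have hrel : pc n x i k = pc n x i j + pc n x j k := by
    rw [pc_eq_sub x (by omega) (by omega), pc_eq_sub x (by omega) (by omega),
      pc_eq_sub x (by omega) (by omega)]
    ring
  rw [dpc_eq_sub m (by omega) (by omega), dpc_eq_sub m (by omega) (by omega),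
    dpc_eq_sub m (by omega) (by omega)]
  generalize pc n x i k = p at *
  subst hrel
  field_simp
  ring

/-- a point x ∈ U is critical for L_T iff the triangular system
[s_{ik}]/p_{ik}(x) + [s_{jk}]/p_{jk}(x) = 0 holds for every triangle of T. -/
theorem critical_iff_triangular_system (n : ℕ) (hn : 4 ≤ n) (T : TwoTree n)
    (s : ℕ × ℕ → ℂ) (hs : Generic n T s) (x : Fin (n - 3) → ℂ) (hx : x ∈ Udom n) :
    IsCrit n (T.edges.erase (1, 2)) s x ↔
      ∀ k, 3 ≤ k → k ≤ n - 1 →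
        brk n T s ((T.par k).1, k) / pc n x (T.par k).1 k
            + brk n T s ((T.par k).2, k) / pc n x (T.par k).2 k = 0 := by
  have hcrit : IsCrit n (T.edges.erase (1, 2)) s x ↔ ∀ m : Fin (n - 3), _ = (0 : ℂ) :=
    forall_congr' fun m => by rw [sum_dpc_eq_sum_triangles hn T s hx m]
  rw [hcrit]
  constructor
  · intro h k
    induction hd : n - 1 - k using Nat.strong_induction_on generalizing k with
    | _ d ih =>
      subst hd
      intro h3 hk
      have hm := h ⟨k - 3, by omega⟩
      rw [Finset.sum_eq_single_of_mem k (Finset.mem_Icc.2 ⟨h3, hk⟩)] at hm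
      · have hlt := T.lt k h3 hk
        simp only [Nat.sub_add_cancel h3] at hm
        rw [if_pos trivial, if_neg (by omega), if_neg (by omega)] at hm
        simpa using hm
      · intro l hl hlk
        obtain ⟨hl3, hl⟩ := Finset.mem_Icc.1 hl
        have hlt := T.lt l hl3 hl
        simp only [Nat.sub_add_cancel h3]
        rcases Nat.lt_or_gt_of_ne hlk with hlk | hlk
        · rw [if_neg (by omega), if_neg (by omega), if_neg (by omega)]
          simp
        · rw [ih _ (by omega) l rfl hl3 hl, zero_mul]
  · intro h m
    refine Finset.sum_eq_zero fun k hk => ?_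
    obtain ⟨h3, hk⟩ := Finset.mem_Icc.1 hk
    rw [h k h3 hk, zero_mul]

end
end MinKin
end
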